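/- Classical core of the ((n,3,d)) structure theorem: let S ⊆ (Fin n → ZMod 2) and let c₂, c₃ ∈ (Fin n → ZMod 2) be such that 0, c₂, c₃ are pairwise distinct. If x + y ∉ S for all distinct x, y ∈ {0, c₂, c₃}, then x + y ∉ S for all distinct x, y ∈ {0, c₂, c₃, c₂ + c₃}. -/

import Mathlib

/-- Length-`n` bit strings. -/
abbrev BitStr (n : ℕ) : Type := Fin n → ZMod 2

theorem stmt8 {n : ℕ} (S : Set (BitStr n)) (c₂ c₃ : BitStr n)
    (h2 : c₂ ≠ 0) (h3 : c₃ ≠ 0) (h23 : c₂ ≠ c₃)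
    (hdet : ∀ x ∈ ({0, c₂, c₃} : Set (BitStr n)),
      ∀ y ∈ ({0, c₂, c₃} : Set (BitStr n)), x ≠ y → x + y ∉ S) :
    ∀ x ∈ ({0, c₂, c₃, c₂ + c₃} : Set (BitStr n)),
      ∀ y ∈ ({0, c₂, c₃, c₂ + c₃} : Set (BitStr n)), x ≠ y → x + y ∉ S := by
  have add_self : ∀ z : BitStr n, z + z = 0 := fun z =>
    funext fun i => CharTwo.add_self_eq_zero (z i)
  have hc₂ : c₂ ∉ S := by simpa using hdet c₂ (by simp) 0 (by simp) h2
  have hc₃ : c₃ ∉ S := by simpa using hdet c₃ (by simp) 0 (by simp) h3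
  have hsum : c₂ + c₃ ∉ S := hdet c₂ (by simp) c₃ (by simp) h23
  have left_cancel : c₂ + (c₂ + c₃) = c₃ := by rw [← add_assoc, add_self, zero_add]
  have right_cancel : c₃ + (c₂ + c₃) = c₂ := by rw [add_left_comm, add_self, add_zero]
  rintro x (rfl | rfl | rfl | rfl) y (rfl | rfl | rfl | rfl) hxy <;>
    first
    | exact absurd rfl hxy
    | simpa only [zero_add, add_zero, left_cancel, right_cancel]
    | rw [add_comm]; simpa only [zero_add, add_zero, left_cancel, right_cancel]
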